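/- arXiv:1901.02051 — 2 statements merged into one kernel-verified Lean document; each statement's English description precedes it below -/
import Mathlib

section
/- Let Y be a finite set with at least two elements, and let P, Q : 2^Y → ℝ be real-valued functions on the subsets of Y. Suppose P is strictly submodular, i.e., P(S) + P(T) > P(S ∪ T) + P(S ∩ T) for all subsets S, T of Y with S ⊄ T and T ⊄ S. If the total variation distance D_TV(P, Q) := (1/2) Σ_{A ⊆ Y} |P(A) − Q(A)| satisfies D_TV(P, Q) ≤ (1/4) · min_{S,T ⊆ Y, S ⊄ T, T ⊄ S} [P(S) + P(T) − P(S ∪ T) − P(S ∩ T)], then Q is submodular, i.e., Q(S) + Q(T) ≥ Q(S ∪ T) + Q(S ∩ T) for all subsets S, T of Y. -/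
/-- Let `Y` be a finite set with at least two elements and
`P Q : 2^Y → ℝ`. If `P` is strictly submodular (strict inequality for all
incomparable pairs `S, T`) and the total variation distance
`D_TV(P,Q) = (1/2) ∑_A |P A − Q A|` is at most
`(1/4) · min_{S ⊄ T, T ⊄ S} [P S + P T − P (S ∪ T) − P (S ∩ T)]`
(equivalently, at most `(1/4)` times every such gap), then `Q` is submodular. -/
theorem dpp_tv_close_to_strictly_submodular_is_submodular
    {Y : Type*} [Fintype Y] [DecidableEq Y] (hY : 1 < Fintype.card Y)
    (P Q : Finset Y → ℝ)
    (hP : ∀ S T : Finset Y, ¬ S ⊆ T → ¬ T ⊆ S →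
      P (S ∪ T) + P (S ∩ T) < P S + P T)
    (hTV : ∀ S T : Finset Y, ¬ S ⊆ T → ¬ T ⊆ S →
      (1 / 2) * ∑ A : Finset Y, |P A - Q A| ≤
        (1 / 4) * (P S + P T - P (S ∪ T) - P (S ∩ T))) :
    ∀ S T : Finset Y, Q (S ∪ T) + Q (S ∩ T) ≤ Q S + Q T := by
  intro S T
  by_cases hST : S ⊆ T
  · rw [Finset.union_eq_right.2 hST, Finset.inter_eq_left.2 hST, add_comm]
  by_cases hTS : T ⊆ S
  · rw [Finset.union_eq_left.2 hTS, Finset.inter_eq_right.2 hTS]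
  have pair_le : ∀ A B : Finset Y, A ≠ B →
      |P A - Q A| + |P B - Q B| ≤ ∑ C : Finset Y, |P C - Q C| := by
    intro A B hAB
    rw [← Finset.sum_pair (f := fun C => |P C - Q C|) hAB]
    exact Finset.sum_le_sum_of_subset_of_nonneg (Finset.subset_univ _)
      fun _ _ _ => abs_nonneg _
  have h₁ := pair_le S T fun h => hST h.subset
  have h₂ := pair_le (S ∪ T) (S ∩ T) fun h =>
    hST (Finset.subset_union_left.trans (h.subset.trans Finset.inter_subset_right))
  have h₃ := hTV S T hST hTS
  linarith [le_abs_self (P S - Q S), le_abs_self (P T - Q T),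
    neg_abs_le (P (S ∪ T) - Q (S ∪ T)), neg_abs_le (P (S ∩ T) - Q (S ∩ T))]
end

section
/- Let Y be a finite set and let P, Q : 2^Y → ℝ be probability distributions on the subsets of Y (P(A) ≥ 0, Q(A) ≥ 0 for all A, and Σ_{A ⊆ Y} P(A) = Σ_{A ⊆ Y} Q(A) = 1), with Q(A) > 0 whenever P(A) > 0. Suppose P is strictly submodular, i.e., P(S) + P(T) > P(S ∪ T) + P(S ∩ T) for all subsets S, T of Y with S ⊄ T and T ⊄ S. Let g = min_{S,T ⊆ Y, S ⊄ T, T ⊄ S} [P(S) + P(T) − P(S ∪ T) − P(S ∩ T)]. If the Kullback–Leibler divergence D_KL(P ‖ Q) = Σ_{A : P(A) > 0} P(A) log(P(A)/Q(A)) satisfies D_KL(P ‖ Q) ≤ g²/8, then Q is submodular: Q(S) + Q(T) ≥ Q(S ∪ T) + Q(S ∩ T) for all subsets S, T of Y. -/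
/-- Each term of the Kullback–Leibler divergence dominates the corresponding term of the
Hellinger distance. -/
theorem two_mul_sub_sqrt_mul_sqrt_le_mul_log_div {p q : ℝ} (hp : 0 ≤ p) (hpq : 0 < p → 0 < q) :
    2 * (p - √p * √q) ≤ p * Real.log (p / q) := by
  rcases hp.eq_or_lt with rfl | hp
  · simp
  have hq := hpq hp
  have hsp := Real.sqrt_pos.2 hp
  have hsq := Real.sqrt_pos.2 hq
  have hlog : Real.log (p / q) = -(2 * Real.log (√q / √p)) := by
    rw [Real.log_div hp.ne' hq.ne', Real.log_div hsq.ne' hsp.ne', Real.log_sqrt hp.le,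
      Real.log_sqrt hq.le]
    ring
  have hle := Real.log_le_sub_one_of_pos (div_pos hsq hsp)
  have hmul : p * (√q / √p) = √p * √q := by
    rw [mul_div_left_comm, Real.div_sqrt, mul_comm]
  rw [hlog]
  nlinarith [mul_le_mul_of_nonneg_left hle hp.le]

/-- A weak form of Pinsker's inequality: the square of the `L¹` distance is at most four times
the Kullback–Leibler divergence. -/
theorem sq_sum_abs_sub_le_four_mul_sum_mul_log {ι : Type*} [Fintype ι] {p q : ι → ℝ}
    (hp : ∀ i, 0 ≤ p i) (hq : ∀ i, 0 ≤ q i) (hp_sum : ∑ i, p i = 1) (hq_sum : ∑ i, q i = 1)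
    (hpq : ∀ i, 0 < p i → 0 < q i) :
    (∑ i, |p i - q i|) ^ 2 ≤ 4 * ∑ i, p i * Real.log (p i / q i) := by
  have hkl : 2 - 2 * ∑ i, √(p i) * √(q i) ≤ ∑ i, p i * Real.log (p i / q i) := by
    have h := Finset.sum_le_sum fun i (_ : i ∈ Finset.univ) =>
      two_mul_sub_sqrt_mul_sqrt_le_mul_log_div (hp i) (hpq i)
    rw [← Finset.mul_sum, Finset.sum_sub_distrib, hp_sum] at h
    linarith
  have hsub : ∑ i, |√(p i) - √(q i)| ^ 2 = 2 - 2 * ∑ i, √(p i) * √(q i) := by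
    have h : ∀ i, |√(p i) - √(q i)| ^ 2 = p i + q i - 2 * (√(p i) * √(q i)) := fun i => by
      rw [sq_abs, sub_sq, Real.sq_sqrt (hp i), Real.sq_sqrt (hq i)]
      ring
    simp only [h, Finset.sum_sub_distrib, Finset.sum_add_distrib, hp_sum, hq_sum,
      ← Finset.mul_sum]
    ring
  have hadd : ∑ i, (√(p i) + √(q i)) ^ 2 = 2 + 2 * ∑ i, √(p i) * √(q i) := by
    have h : ∀ i, (√(p i) + √(q i)) ^ 2 = p i + q i + 2 * (√(p i) * √(q i)) := fun i => by
      rw [add_sq, Real.sq_sqrt (hp i), Real.sq_sqrt (hq i)]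
      ring
    simp only [h, Finset.sum_add_distrib, hp_sum, hq_sum, ← Finset.mul_sum]
    ring
  have hfactor : ∀ i, |p i - q i| = |√(p i) - √(q i)| * (√(p i) + √(q i)) := fun i => by
    rw [← abs_of_nonneg (add_nonneg (Real.sqrt_nonneg (p i)) (Real.sqrt_nonneg (q i))),
      ← abs_mul]
    congr 1
    linear_combination Real.sq_sqrt (hq i) - Real.sq_sqrt (hp i)
  have hcs := Finset.sum_mul_sq_le_sq_mul_sq Finset.univ
    (fun i => |√(p i) - √(q i)|) (fun i => √(p i) + √(q i))
  simp only [← hfactor, hsub, hadd] at hcs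
  nlinarith [sq_nonneg (1 - ∑ i, √(p i) * √(q i))]

/-- Let `Y` be a finite set and `P Q : 2^Y → ℝ` probability
distributions over the subsets of `Y`, with `Q` positive wherever `P` is
(absolute continuity). Suppose `P` is strictly submodular and let `g` be the
minimum submodularity gap `P S + P T − P (S∪T) − P (S∩T)` over incomparable
pairs `S, T` (characterized as a lower bound that is attained). If the
Kullback–Leibler divergence
`D_KL(P‖Q) = ∑_{A : P A > 0} P A * log (P A / Q A)` is at most `g² / 8`,
then `Q` is submodular. -/
theorem kl_close_to_strictly_submodular_is_submodular
    {Y : Type*} [Fintype Y] [DecidableEq Y]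
    (P Q : Finset Y → ℝ)
    (hP_nonneg : ∀ A : Finset Y, 0 ≤ P A)
    (hQ_nonneg : ∀ A : Finset Y, 0 ≤ Q A)
    (hP_sum : ∑ A : Finset Y, P A = 1)
    (hQ_sum : ∑ A : Finset Y, Q A = 1)
    (habs : ∀ A : Finset Y, 0 < P A → 0 < Q A)
    (hP : ∀ S T : Finset Y, ¬ S ⊆ T → ¬ T ⊆ S →
      P (S ∪ T) + P (S ∩ T) < P S + P T)
    (g : ℝ)
    (hg_le : ∀ S T : Finset Y, ¬ S ⊆ T → ¬ T ⊆ S →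
      g ≤ P S + P T - P (S ∪ T) - P (S ∩ T))
    (hg_attained : ∃ S T : Finset Y, ¬ S ⊆ T ∧ ¬ T ⊆ S ∧
      g = P S + P T - P (S ∪ T) - P (S ∩ T))
    (hKL : ∑ A ∈ Finset.univ.filter (fun A : Finset Y => 0 < P A),
        P A * Real.log (P A / Q A) ≤ g ^ 2 / 8) :
    ∀ S T : Finset Y, Q (S ∪ T) + Q (S ∩ T) ≤ Q S + Q T := by
  intro S T
  by_cases hST : S ⊆ T
  · rw [Finset.union_eq_right.2 hST, Finset.inter_eq_left.2 hST, add_comm]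
  by_cases hTS : T ⊆ S
  · rw [Finset.union_eq_left.2 hTS, Finset.inter_eq_right.2 hTS]
  have hg_nonneg : 0 ≤ g := by
    obtain ⟨S', T', h₁, h₂, rfl⟩ := hg_attained
    linarith [hP S' T' h₁ h₂]
  have hfilter : ∑ A ∈ Finset.univ.filter (fun A : Finset Y => 0 < P A),
      P A * Real.log (P A / Q A) = ∑ A, P A * Real.log (P A / Q A) :=
    Finset.sum_filter_of_ne fun A _ h =>
      (hP_nonneg A).lt_of_ne' (left_ne_zero_of_mul h)
  have hdist : ∑ A, |P A - Q A| ≤ g := by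
    refine le_of_sq_le_sq ?_ hg_nonneg
    have := sq_sum_abs_sub_le_four_mul_sum_mul_log hP_nonneg hQ_nonneg hP_sum hQ_sum habs
    nlinarith [sq_nonneg g]
  have hfour : |P S - Q S| + (|P T - Q T| + (|P (S ∪ T) - Q (S ∪ T)| +
      |P (S ∩ T) - Q (S ∩ T)|)) ≤ ∑ A, |P A - Q A| := by
    have hS_T : S ≠ T := fun h => hST h.subset
    have hS_union : S ≠ S ∪ T := fun h => hTS (Finset.union_eq_left.1 h.symm)
    have hS_inter : S ≠ S ∩ T := fun h => hST (Finset.inter_eq_left.1 h.symm)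
    have hT_union : T ≠ S ∪ T := fun h => hST (Finset.union_eq_right.1 h.symm)
    have hT_inter : T ≠ S ∩ T := fun h => hTS (Finset.inter_eq_right.1 h.symm)
    have hunion_inter : S ∪ T ≠ S ∩ T := fun h =>
      hST (Finset.subset_union_left.trans (h.subset.trans Finset.inter_subset_right))
    have h := Finset.sum_le_univ_sum_of_nonneg (s := {S, T, S ∪ T, S ∩ T})
      fun A => abs_nonneg (P A - Q A)
    rwa [Finset.sum_insert (by simp only [Finset.mem_insert, Finset.mem_singleton]; tauto),
      Finset.sum_insert (by simp only [Finset.mem_insert, Finset.mem_singleton]; tauto),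
      Finset.sum_pair hunion_inter] at h
  linarith [hg_le S T hST hTS, le_abs_self (P S - Q S), le_abs_self (P T - Q T),
    neg_abs_le (P (S ∪ T) - Q (S ∪ T)), neg_abs_le (P (S ∩ T) - Q (S ∩ T))]
end
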